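/- Let L be a finite field extension of ℚ₂ of odd degree, and let 𝔒 be its ring of integers; assume 2 is a prime element of 𝔒. Then the quadratic form x² + y² + z² is anisotropic over 𝔒: if x, y, z ∈ 𝔒 satisfy x² + y² + z² = 0, then x = y = z = 0. -/

import Mathlib

/-- The norm form `x² + xy + y²` of `𝔽₄ / 𝔽₂` is anisotropic over a finite domain whose
cardinality is an odd power of two. -/
theorem eq_zero_of_sq_add_mul_add_sq_eq_zero {k : Type*} [CommRing k] [IsDomain k] [Finite k]
    {n : ℕ} (hn : Odd n) (hcard : Nat.card k = 2 ^ n) {x y : k}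
    (h : x ^ 2 + x * y + y ^ 2 = 0) : x = 0 ∧ y = 0 := by
  have hpow (a : k) : a ^ 2 ^ n = a := by
    let := (Finite.isDomain_to_isField k).toField
    let := Fintype.ofFinite k
    rw [← hcard, Nat.card_eq_fintype_card]
    exact FiniteField.pow_card a
  have h_two : (2 : k) = 0 := by
    let := Fintype.ofFinite k
    have h0 : ((2 ^ n : ℕ) : k) = 0 := by
      rw [← hcard, Nat.card_eq_fintype_card]
      exact Nat.cast_card_eq_zero k
    push_cast at h0
    exact pow_eq_zero_iff hn.pos.ne' |>.mp h0
  obtain ⟨j, hj⟩ : ∃ j, 2 ^ n = 3 * j + 2 := by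
    obtain ⟨m, rfl⟩ := hn
    refine ⟨2 ^ (2 * m + 1) / 3, ?_⟩
    have : 2 ^ (2 * m + 1) % 3 = 2 := by
      simp [pow_succ, pow_mul, Nat.mul_mod, Nat.pow_mod]
    simpa only [this] using (Nat.div_add_mod (2 ^ (2 * m + 1)) 3).symm
  have h_cube : x ^ 3 = y ^ 3 := by linear_combination (x - y) * h
  have hx : x = (y ^ 3) ^ j * x ^ 2 := by
    rw [← h_cube, ← pow_mul, ← pow_add, ← hj, hpow]
  have hy : y = (y ^ 3) ^ j * y ^ 2 := by
    rw [← pow_mul, ← pow_add, ← hj, hpow]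
  have h_prod : x * y * (x - y) = 0 := by
    linear_combination x ^ 2 * hy - y ^ 2 * hx
  rcases mul_eq_zero.mp h_prod with h_prod | h_eq
  · rcases mul_eq_zero.mp h_prod with rfl | rfl <;> simpa using h
  · obtain rfl := sub_eq_zero.mp h_eq
    have : x ^ 2 = 0 := by linear_combination h - x ^ 2 * h_two
    simpa using this

/-- If `2` is a prime element of a ring whose reduction modulo `2` has cardinality an odd power
of two, then `2` divides every coordinate of a zero of `x² + y² + z²`. -/
theorem two_dvd_of_sum_three_sq_eq_zero {R : Type*} [CommRing R] [IsDomain R]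
    (h2 : Prime (2 : R)) {n : ℕ} (hn : Odd n)
    (hcard : Nat.card (R ⧸ Ideal.span {(2 : R)}) = 2 ^ n) {x y z : R}
    (h : x ^ 2 + y ^ 2 + z ^ 2 = 0) : 2 ∣ x ∧ 2 ∣ y ∧ 2 ∣ z := by
  have h_sum : 2 ∣ x + y + z := by
    refine h2.dvd_of_dvd_pow (n := 2) ⟨x * y + y * z + z * x, ?_⟩
    linear_combination h
  obtain ⟨t, ht⟩ := h_sum
  have h_form : x ^ 2 + x * y + y ^ 2 = 2 * (t * (x + y) - t ^ 2) := by
    obtain rfl : z = 2 * t - x - y := by linear_combination ht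
    apply mul_left_cancel₀ h2.ne_zero
    linear_combination h
  have : (Ideal.span {(2 : R)}).IsPrime := (Ideal.span_singleton_prime h2.ne_zero).mpr h2
  have : Finite (R ⧸ Ideal.span {(2 : R)}) := Nat.finite_of_card_ne_zero (by simp [hcard])
  have key := eq_zero_of_sq_add_mul_add_sq_eq_zero hn hcard
    (x := Ideal.Quotient.mk _ x) (y := Ideal.Quotient.mk _ y) (by
      rw [← map_pow, ← map_mul, ← map_pow, ← map_add, ← map_add, Ideal.Quotient.eq_zero_iff_dvd]
      exact ⟨_, h_form⟩)
  rw [Ideal.Quotient.eq_zero_iff_dvd, Ideal.Quotient.eq_zero_iff_dvd] at key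
  obtain ⟨hx, hy⟩ := key
  refine ⟨hx, hy, ?_⟩
  obtain rfl : z = 2 * t - x - y := by linear_combination ht
  exact ((dvd_mul_right 2 t).sub hx).sub hy

/-- The special fibre of a finite free algebra over a local ring has cardinality that of the residue
field to the power of the rank. -/
theorem natCard_quotient_map_maximalIdeal (R S : Type*) [CommRing R] [IsLocalRing R] [CommRing S]
    [Algebra R S] [Module.Free R S] [Module.Finite R S] :
    Nat.card (S ⧸ (IsLocalRing.maximalIdeal R).map (algebraMap R S)) =
      Nat.card (IsLocalRing.ResidueField R) ^ Module.finrank R S := by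
  let : Field (R ⧸ IsLocalRing.maximalIdeal R) := Ideal.Quotient.field _
  have : Module.Finite (R ⧸ IsLocalRing.maximalIdeal R)
      (S ⧸ (IsLocalRing.maximalIdeal R).map (algebraMap R S)) :=
    Module.Finite.of_restrictScalars_finite R _ _
  rw [Module.natCard_eq_pow_finrank (K := R ⧸ IsLocalRing.maximalIdeal R),
    IsLocalRing.finrank_quotient_map]
  rfl

/-- The reduction modulo `p` of the ring of integers of a finite extension of `ℚ_[p]` has
cardinality `p` to the power of the degree. -/
theorem natCard_integralClosure_padicInt_quotient (p : ℕ) [Fact p.Prime]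
    (L : Type*) [Field L] [Algebra ℚ_[p] L] [FiniteDimensional ℚ_[p] L]
    [Algebra ℤ_[p] L] [IsScalarTower ℤ_[p] ℚ_[p] L] :
    Nat.card (integralClosure ℤ_[p] L ⧸ Ideal.span {(p : integralClosure ℤ_[p] L)}) =
      p ^ Module.finrank ℚ_[p] L := by
  have : Module.Finite ℤ_[p] (integralClosure ℤ_[p] L) :=
    IsIntegralClosure.finite ℤ_[p] ℚ_[p] L _
  have : Module.IsTorsionFree ℤ_[p] L := .trans_faithfulSMul ℤ_[p] ℚ_[p] L
  have : Module.Free ℤ_[p] (integralClosure ℤ_[p] L) :=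
    IsIntegralClosure.module_free ℤ_[p] ℚ_[p] L _
  have h_map : Ideal.span {(p : integralClosure ℤ_[p] L)} =
      (IsLocalRing.maximalIdeal ℤ_[p]).map (algebraMap ℤ_[p] (integralClosure ℤ_[p] L)) := by
    simp [PadicInt.maximalIdeal_eq_span_p, Ideal.map_span]
  have h_card : Nat.card (IsLocalRing.ResidueField ℤ_[p]) = p := by
    rw [Nat.card_congr (PadicInt.residueField (p := p)).toEquiv, Nat.card_zmod]
  rw [h_map, natCard_quotient_map_maximalIdeal, h_card,
    IsIntegralClosure.rank ℤ_[p] ℚ_[p] L]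

/-- Let `L` be a finite extension of `ℚ₂` of odd degree with ring of
integers `𝔒 = integralClosure ℤ₂ L`, and assume `2` is a prime element of `𝔒`. Then
the form `x² + y² + z²` is anisotropic over `𝔒`: if `x² + y² + z² = 0` with
`x, y, z ∈ 𝔒`, then `x = y = z = 0`. -/
theorem sum_of_three_squares_anisotropic_in_odd_unramified_dyadic
    (L : Type*) [Field L] [Algebra ℚ_[2] L] [FiniteDimensional ℚ_[2] L]
    [Algebra ℤ_[2] L] [IsScalarTower ℤ_[2] ℚ_[2] L]
    (hodd : Odd (Module.finrank ℚ_[2] L))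
    (h2 : Prime (2 : integralClosure ℤ_[2] L))
    (x y z : integralClosure ℤ_[2] L) (h : x ^ 2 + y ^ 2 + z ^ 2 = 0) :
    x = 0 ∧ y = 0 ∧ z = 0 := by
  have : IsNoetherianRing (integralClosure ℤ_[2] L) :=
    IsIntegralClosure.isNoetherianRing ℤ_[2] ℚ_[2] L _
  have hcard := natCard_integralClosure_padicInt_quotient 2 L
  rw [Nat.cast_ofNat] at hcard
  have h_dvd (n : ℕ) : ∀ x y z : integralClosure ℤ_[2] L, x ^ 2 + y ^ 2 + z ^ 2 = 0 →
      2 ^ n ∣ x ∧ 2 ^ n ∣ y ∧ 2 ^ n ∣ z := by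
    induction n with
    | zero => simp
    | succ n ih =>
      intro x y z h
      obtain ⟨⟨x, rfl⟩, ⟨y, rfl⟩, ⟨z, rfl⟩⟩ := two_dvd_of_sum_three_sq_eq_zero h2 hodd hcard h
      obtain ⟨hx, hy, hz⟩ := ih x y z <| by
        apply mul_left_cancel₀ (pow_ne_zero 2 h2.ne_zero)
        linear_combination h
      simp only [pow_succ']
      exact ⟨mul_dvd_mul_left 2 hx, mul_dvd_mul_left 2 hy, mul_dvd_mul_left 2 hz⟩
  have h_zero (a : integralClosure ℤ_[2] L) (ha : ∀ n : ℕ, 2 ^ n ∣ a) : a = 0 := by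
    by_contra h_ne
    obtain ⟨n, hn⟩ := FiniteMultiplicity.of_not_isUnit h2.not_isUnit h_ne
    exact hn (ha _)
  exact ⟨h_zero x fun n ↦ (h_dvd n x y z h).1, h_zero y fun n ↦ (h_dvd n x y z h).2.1,
    h_zero z fun n ↦ (h_dvd n x y z h).2.2⟩
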